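/- Let J̄ ≥ max_{i∈V} Σ_{j∈V} |J_{ij}|. Then for all i, h ∈ V with h ≠ i, ρ_h(φ_i) ≤ 4 e^{2J̄} |J_{ih}|, and for h = i, ρ_i(φ_i) ≤ 2 sinh(2J̄). -/

import Mathlib

open Finset

section defs

/-- The spin value of a Boolean: `true ↦ 1`, `false ↦ -1`. -/
def spin (b : Bool) : ℝ := if b then 1 else -1

variable {ι : Type*} [Fintype ι] [DecidableEq ι]

/-- The configuration `σ` with the spin at site `j` flipped. -/
def flipAt (σ : ι → Bool) (j : ι) : ι → Bool := Function.update σ j (!σ j)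

/-- `ρ_j(g) = max_σ |g(σ) - g(σ^j)|`. -/
noncomputable def rho (j : ι) (g : (ι → Bool) → ℝ) : ℝ :=
  Finset.univ.sup' Finset.univ_nonempty fun σ => |g σ - g (flipAt σ j)|

/-- Expectation of `g` under the (finitely supported) measure `π`. -/
noncomputable def Emean {α : Type*} [Fintype α] (π g : α → ℝ) : ℝ := ∑ x, π x * g x

/-- Variance of `g` under `π`. -/
noncomputable def Var {α : Type*} [Fintype α] (π g : α → ℝ) : ℝ :=
  Emean π (fun x => g x ^ 2) - (Emean π g) ^ 2

/-- Covariance of `f` and `g` under `π`. -/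
noncomputable def Cov {α : Type*} [Fintype α] (π f g : α → ℝ) : ℝ :=
  Emean π (fun x => f x * g x) - Emean π f * Emean π g

/-- Total variation distance `(1/2) Σ_x |μ(x) - ν(x)|`. -/
noncomputable def tv {α : Type*} [Fintype α] (μ ν : α → ℝ) : ℝ :=
  (1 / 2) * ∑ x, |μ x - ν x|

/-- `h_i(σ) = -Σ_j J_{ij} σ_j`. -/
noncomputable def hfun (J : ι → ι → ℝ) (i : ι) (σ : ι → Bool) : ℝ :=
  -∑ j, J i j * spin (σ j)

/-- `h_{i,l}(σ) = -Σ_{j ≠ l} J_{ij} σ_j`. -/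
noncomputable def hil (J : ι → ι → ℝ) (i l : ι) (σ : ι → Bool) : ℝ :=
  -∑ j ∈ Finset.univ.erase l, J i j * spin (σ j)

/-- `H(σ) = -Σ_{i,j} J_{ij} σ_i σ_j` (equals `-Σ_{i≠j}` since `J_{ii}=0`). -/
noncomputable def Ham (J : ι → ι → ℝ) (σ : ι → Bool) : ℝ :=
  -∑ i, ∑ j, J i j * spin (σ i) * spin (σ j)

/-- The Gibbs measure `π^G(σ) = e^{-H(σ)} / Σ_τ e^{-H(τ)}`. -/
noncomputable def piG (J : ι → ι → ℝ) (σ : ι → Bool) : ℝ :=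
  Real.exp (-Ham J σ) / ∑ τ : ι → Bool, Real.exp (-Ham J τ)

/-- `φ_i(σ) = exp(-2 Σ_j J_{ij} σ_i σ_j)`. -/
noncomputable def phi (J : ι → ι → ℝ) (i : ι) (σ : ι → Bool) : ℝ :=
  Real.exp (-2 * ∑ j, J i j * spin (σ i) * spin (σ j))

/-- `f_δ(σ) = Π_i (1 + δ φ_i(σ))`. -/
noncomputable def fδ (J : ι → ι → ℝ) (δ : ℝ) (σ : ι → Bool) : ℝ :=
  ∏ i, (1 + δ * phi J i σ)

/-- The PCA stationary measure `π^{PCA}(σ) = π^G(σ) f(σ) / π^G(f)`. -/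
noncomputable def piPCA (J : ι → ι → ℝ) (δ : ℝ) (σ : ι → Bool) : ℝ :=
  piG J σ * fδ J δ σ / Emean (piG J) (fδ J δ)

/-- The measure `π̃(σ) = π^G(σ) f(σ)² / π^G(f²)`. -/
noncomputable def piTilde (J : ι → ι → ℝ) (δ : ℝ) (σ : ι → Bool) : ℝ :=
  piG J σ * (fδ J δ σ) ^ 2 / Emean (piG J) (fun τ => (fδ J δ τ) ^ 2)

/-- `Σ_{i∈V} φ_i/(1 + δ φ_i)`. -/
noncomputable def Gsum (J : ι → ι → ℝ) (δ : ℝ) (σ : ι → Bool) : ℝ :=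
  ∑ i, phi J i σ / (1 + δ * phi J i σ)

/-- The conditional probability `π(σ_i = 1 | σ restricted to V∖{i})`. -/
noncomputable def condProb (π : (ι → Bool) → ℝ) (i : ι) (σ : ι → Bool) : ℝ :=
  π (Function.update σ i true) /
    (π (Function.update σ i true) + π (Function.update σ i false))

/-- The Dobrushin coefficient `γ_{ij} = max_σ |π(σ_i=1|σ_{∖i}) - π(σ_i=1|σ^j_{∖i})|`. -/
noncomputable def dobr (π : (ι → Bool) → ℝ) (i j : ι) : ℝ :=
  Finset.univ.sup' Finset.univ_nonempty fun σ =>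
    |condProb π i σ - condProb π i (flipAt σ j)|

/-- `ψ_{i,δ}` from the local-specification computation. -/
noncomputable def psi (J : ι → ι → ℝ) (δ : ℝ) (i : ι) (σ : ι → Bool) : ℝ :=
  (1 / 2) *
    (Real.log ((1 + δ * Real.exp (-2 * hfun J i σ)) / (1 + δ * Real.exp (2 * hfun J i σ))) +
      ∑ l ∈ Finset.univ.erase i,
        Real.log
          ((1 + δ * Real.exp (-2 * J i l * spin (σ l) - 2 * spin (σ l) * hil J i l σ)) /
            (1 + δ * Real.exp (2 * J i l * spin (σ l) - 2 * spin (σ l) * hil J i l σ))))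

/-- The pair Hamiltonian `H(σ,σ') = Σ_i [h_i(σ) σ'_i + q(1 - σ_i σ'_i)]`. -/
noncomputable def Hpair (J : ι → ι → ℝ) (q : ℝ) (σ σ' : ι → Bool) : ℝ :=
  ∑ i, (hfun J i σ * spin (σ' i) + q * (1 - spin (σ i) * spin (σ' i)))

/-- `Z_σ = Σ_τ e^{-H(σ,τ)}`. -/
noncomputable def Zconf (J : ι → ι → ℝ) (q : ℝ) (σ : ι → Bool) : ℝ :=
  ∑ τ : ι → Bool, Real.exp (-Hpair J q σ τ)

/-- The PCA transition probability `P^{PCA}_{σ,σ'} = e^{-H(σ,σ')}/Z_σ`. -/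
noncomputable def Ppca (J : ι → ι → ℝ) (q : ℝ) (σ σ' : ι → Bool) : ℝ :=
  Real.exp (-Hpair J q σ σ') / Zconf J q σ

/-- The PCA stationary measure written as `π^{PCA}(σ) = Z_σ / Σ_τ Z_τ`. -/
noncomputable def piPCAq (J : ι → ι → ℝ) (q : ℝ) (σ : ι → Bool) : ℝ :=
  Zconf J q σ / ∑ τ : ι → Bool, Zconf J q τ

end defs

/-- Restriction of an interaction on an infinite site space to a finite volume `V`. -/
def Jres {α : Type*} (J : α → α → ℝ) (V : Finset α) : ↥V → ↥V → ℝ :=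
  fun a b => J a.1 b.1

theorem abs_spin (b : Bool) : |spin b| = 1 := by cases b <;> simp [spin]

theorem spin_not (b : Bool) : spin (!b) = -spin b := by cases b <;> simp [spin]

theorem spin_flipAt {ι : Type*} [DecidableEq ι] (σ : ι → Bool) (h j : ι) :
    spin (flipAt σ h j) = if j = h then -spin (σ j) else spin (σ j) := by
  unfold flipAt
  split_ifs with hj
  · subst hj; simp [spin_not]
  · simp [hj]

theorem abs_localField_le {ι : Type*} [Fintype ι] (J : ι → ι → ℝ) (i : ι) (σ : ι → Bool) :
    |∑ j, J i j * spin (σ i) * spin (σ j)| ≤ ∑ j, |J i j| := by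
  refine (Finset.abs_sum_le_sum_abs _ _).trans_eq (Finset.sum_congr rfl fun j _ => ?_)
  simp [abs_mul, abs_spin]

theorem localField_sub_flipAt_of_ne {ι : Type*} [Fintype ι] [DecidableEq ι] (J : ι → ι → ℝ)
    {i h : ι} (hne : h ≠ i) (σ : ι → Bool) :
    ∑ j, J i j * spin (σ i) * spin (σ j)
      - ∑ j, J i j * spin (flipAt σ h i) * spin (flipAt σ h j)
      = 2 * (J i h * spin (σ i) * spin (σ h)) := by
  rw [← Finset.sum_sub_distrib, Finset.sum_eq_single h]
  · simp only [spin_flipAt, if_neg hne.symm, if_true]; ring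
  · intro j _ hj
    simp [spin_flipAt, hne.symm, hj]
  · simp

theorem localField_flipAt_self {ι : Type*} [Fintype ι] [DecidableEq ι] (J : ι → ι → ℝ)
    {i : ι} (hdiag : J i i = 0) (σ : ι → Bool) :
    ∑ j, J i j * spin (flipAt σ i i) * spin (flipAt σ i j)
      = -∑ j, J i j * spin (σ i) * spin (σ j) := by
  rw [← Finset.sum_neg_distrib]
  refine Finset.sum_congr rfl fun j _ => ?_
  by_cases hj : j = i
  · subst hj; simp [hdiag]
  · simp [spin_flipAt, hj]

theorem Real.abs_exp_sub_exp_le {a b M : ℝ} (ha : a ≤ M) (hb : b ≤ M) :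
    |Real.exp a - Real.exp b| ≤ Real.exp M * |a - b| := by
  wlog hab : b ≤ a generalizing a b
  · rw [abs_sub_comm, abs_sub_comm a]
    exact this hb ha (le_of_not_ge hab)
  rw [abs_of_nonneg (sub_nonneg.2 (Real.exp_le_exp.2 hab)), abs_of_nonneg (sub_nonneg.2 hab)]
  have hba : Real.exp b = Real.exp a * Real.exp (b - a) := by
    rw [← Real.exp_add]; ring_nf
  calc Real.exp a - Real.exp b = Real.exp a * (1 - Real.exp (b - a)) := by rw [hba]; ring
    _ ≤ Real.exp a * (a - b) :=
      mul_le_mul_of_nonneg_left (by linarith [Real.add_one_le_exp (b - a)]) (Real.exp_pos a).le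
    _ ≤ Real.exp M * (a - b) :=
      mul_le_mul_of_nonneg_right (Real.exp_le_exp.2 ha) (sub_nonneg.2 hab)

/-- With `J̄ ≥ max_i Σ_j |J_{ij}|`, for `h ≠ i` one has
`ρ_h(φ_i) ≤ 4 e^{2J̄} |J_{ih}|`, and `ρ_i(φ_i) ≤ 2 sinh(2J̄)`. -/
theorem rho_phi_bounds {ι : Type*} [Fintype ι] [DecidableEq ι] [Nonempty ι]
    (J : ι → ι → ℝ) (hsym : ∀ i j, J i j = J j i) (hdiag : ∀ i, J i i = 0)
    (Jbar : ℝ) (hJbar : ∀ i, ∑ j, |J i j| ≤ Jbar) :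
    (∀ i h : ι, h ≠ i → rho h (phi J i) ≤ 4 * Real.exp (2 * Jbar) * |J i h|) ∧
    (∀ i : ι, rho i (phi J i) ≤ 2 * Real.sinh (2 * Jbar)) := by
  have hbound (i : ι) (σ : ι → Bool) : |∑ j, J i j * spin (σ i) * spin (σ j)| ≤ Jbar :=
    (abs_localField_le J i σ).trans (hJbar i)
  refine ⟨fun i h hne => Finset.sup'_le _ _ fun σ _ => ?_,
    fun i => Finset.sup'_le _ _ fun σ _ => ?_⟩
  · have h₁ := (abs_le.1 (hbound i σ)).1
    have h₂ := (abs_le.1 (hbound i (flipAt σ h))).1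
    refine (Real.abs_exp_sub_exp_le (M := 2 * Jbar) (by linarith) (by linarith)).trans_eq ?_
    rw [← mul_sub, localField_sub_flipAt_of_ne J hne]
    simp only [abs_mul, abs_spin, abs_neg, abs_two]
    ring
  · unfold phi
    rw [localField_flipAt_self J (hdiag i)]
    have hS := abs_le.1 (hbound i σ)
    set S := ∑ j, J i j * spin (σ i) * spin (σ j)
    have h₁ := Real.exp_le_exp.2 (show -2 * S ≤ 2 * Jbar by linarith)
    have h₂ := Real.exp_le_exp.2 (show -2 * -S ≤ 2 * Jbar by linarith)
    have h₃ := Real.exp_le_exp.2 (show -(2 * Jbar) ≤ -2 * S by linarith)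
    have h₄ := Real.exp_le_exp.2 (show -(2 * Jbar) ≤ -2 * -S by linarith)
    rw [Real.sinh_eq, abs_le]
    constructor <;> linarith
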